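/- For each n ≥ 1, let r_n : ℤ_{≥1} → [0,1] be a nonincreasing function with r_n(1) = 1, define λ_i(n) := −Σ_{k=1}^∞ r_n(k)·( log(1 − 1/(k+n)) + 1/(k+n−i) ) for 1 ≤ i ≤ n, and define c(n) := Σ_{k=1}^∞ r_n(k)/(k+n−1)². Then for each fixed i ≥ 1, c(n)^{−1}·(λ_i(n) − λ_1(n)) → −i + 1 as n → ∞. -/

import Mathlib

open MeasureTheory ProbabilityTheory Matrix Filter

noncomputable section

/-- The Lyapunov exponent `λ_i(n) = -∑_{k≥1} r(k) (log(1 - 1/(k+n)) + 1/(k+n-i))`,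
for a tail-frequency function `r` (indexed so that the sum below is over `k = 1, 2, …`). -/
def lam (r : ℕ → ℝ) (n i : ℕ) : ℝ :=
  -∑' k : ℕ, r (k + 1) *
    (Real.log (1 - 1 / ((k : ℝ) + 1 + n)) + 1 / ((k : ℝ) + 1 + n - i))

/-- The constant `c(n) = ∑_{k≥1} r(k)/(k+n-1)²`. -/
def cn (r : ℕ → ℝ) (n : ℕ) : ℝ := ∑' k : ℕ, r (k + 1) / ((k : ℝ) + n) ^ 2

theorem summable_one_div_nat_add_sq (a : ℝ) :
    Summable fun k : ℕ => 1 / ((k : ℝ) + a) ^ 2 := by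
  have h := (Real.summable_one_div_nat_add_rpow a 2).2 one_lt_two
  simpa using h

theorem neg_one_div_le_log_one_sub {x : ℝ} (hx : 0 < x) :
    -(1 / x) ≤ Real.log (1 - 1 / (x + 1)) := by
  have hpos : 0 < 1 - 1 / (x + 1) := by
    have : 1 - 1 / (x + 1) = x / (x + 1) := by field_simp; ring
    rw [this]; positivity
  have h := Real.one_sub_inv_le_log_of_pos hpos
  have e : 1 - (1 - 1 / (x + 1))⁻¹ = -(1 / x) := by
    have : 1 - 1 / (x + 1) = x / (x + 1) := by field_simp; ring
    rw [this]; field_simp; ring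
  linarith

theorem log_one_sub_le_neg_one_div {x : ℝ} (hx : 0 < x) :
    Real.log (1 - 1 / (x + 1)) ≤ -(1 / (x + 1)) := by
  have hpos : 0 < 1 - 1 / (x + 1) := by
    have : 1 - 1 / (x + 1) = x / (x + 1) := by field_simp; ring
    rw [this]; positivity
  linarith [Real.log_le_sub_one_of_pos hpos]

theorem abs_log_one_sub_add_one_div_le {x m : ℝ} (hm : 0 ≤ m) (hx : m < x) :
    |Real.log (1 - 1 / (x + 1)) + 1 / (x - m)| ≤ (m + 1) * (1 / (x - m) ^ 2) := by
  have hx0 : 0 < x := hm.trans_lt hx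
  have hxm : 0 < x - m := sub_pos.2 hx
  have h1 := neg_one_div_le_log_one_sub hx0
  have h2 := log_one_sub_le_neg_one_div hx0
  have h3 : 1 / x ≤ 1 / (x - m) := one_div_le_one_div_of_le hxm (by linarith)
  have h4 : 1 / (x - m) - 1 / (x + 1) = (m + 1) * (1 / ((x - m) * (x + 1))) := by
    field_simp; ring
  have h5 : (m + 1) * (1 / ((x - m) * (x + 1))) ≤ (m + 1) * (1 / (x - m) ^ 2) := by
    apply mul_le_mul_of_nonneg_left _ (by linarith)
    apply one_div_le_one_div_of_le (by positivity)
    rw [sq]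
    exact mul_le_mul_of_nonneg_left (by linarith) hxm.le
  rw [abs_of_nonneg (by linarith)]
  linarith

theorem summable_cn {r : ℕ → ℝ} (hr : ∀ k, 1 ≤ k → r k ∈ Set.Icc (0 : ℝ) 1) (n : ℕ) :
    Summable fun k : ℕ => r (k + 1) / ((k : ℝ) + n) ^ 2 := by
  refine Summable.of_nonneg_of_le (fun k => ?_) (fun k => ?_) (summable_one_div_nat_add_sq n)
  · exact div_nonneg (hr _ (by omega)).1 (sq_nonneg _)
  · exact div_le_div_of_nonneg_right (hr _ (by omega)).2 (sq_nonneg _)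

theorem summable_lam {r : ℕ → ℝ} (hr : ∀ k, 1 ≤ k → r k ∈ Set.Icc (0 : ℝ) 1)
    {n i : ℕ} (hi : 1 ≤ i) (hin : i ≤ n) :
    Summable fun k : ℕ => r (k + 1) *
      (Real.log (1 - 1 / ((k : ℝ) + 1 + n)) + 1 / ((k : ℝ) + 1 + n - i)) := by
  have hi' : (1 : ℝ) ≤ i := by exact_mod_cast hi
  have hin' : (i : ℝ) ≤ n := by exact_mod_cast hin
  refine Summable.of_norm_bounded
    ((summable_one_div_nat_add_sq ((n : ℝ) - (i - 1))).mul_left ((i : ℝ) - 1 + 1)) fun k => ?_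
  have hk : (0 : ℝ) ≤ k := k.cast_nonneg
  have h := abs_log_one_sub_add_one_div_le (x := (k : ℝ) + n) (m := (i : ℝ) - 1)
    (by linarith) (by linarith)
  obtain ⟨h0, h1⟩ := hr (k + 1) (by omega)
  rw [Real.norm_eq_abs, abs_mul, abs_of_nonneg h0]
  rw [show (k : ℝ) + n + 1 = k + 1 + n by ring,
    show (k : ℝ) + n - (i - 1) = k + 1 + n - i by ring] at h
  rw [show (k : ℝ) + (n - (i - 1)) = k + 1 + n - i by ring]
  exact (mul_le_of_le_one_left (abs_nonneg _) h1).trans h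

theorem cn_pos {r : ℕ → ℝ} (hr : ∀ k, 1 ≤ k → r k ∈ Set.Icc (0 : ℝ) 1) (hr1 : r 1 = 1)
    {n : ℕ} (hn : 1 ≤ n) : 0 < cn r n := by
  have hn' : (0 : ℝ) < n := by exact_mod_cast hn
  refine (summable_cn hr n).tsum_pos
    (fun k => div_nonneg (hr _ (by omega)).1 (sq_nonneg _)) 0 ?_
  simp only [zero_add, hr1, Nat.cast_zero]
  positivity

theorem lam_one_sub_lam_mem_Icc {r : ℕ → ℝ} (hr : ∀ k, 1 ≤ k → r k ∈ Set.Icc (0 : ℝ) 1)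
    {n i : ℕ} (hi : 1 ≤ i) (hin : i ≤ n) :
    lam r n 1 - lam r n i ∈ Set.Icc (((i : ℝ) - 1) * cn r n)
      (((i : ℝ) - 1) * ((n : ℝ) / (n - (i - 1))) * cn r n) := by
  have hi' : (1 : ℝ) ≤ i := by exact_mod_cast hi
  have hin' : (i : ℝ) ≤ n := by exact_mod_cast hin
  have hsi := summable_lam hr hi hin
  have hs1 := summable_lam hr le_rfl (hi.trans hin)
  have hdiff : lam r n 1 - lam r n i = ∑' k : ℕ, (r (k + 1) *
      (Real.log (1 - 1 / ((k : ℝ) + 1 + n)) + 1 / ((k : ℝ) + 1 + n - i)) - r (k + 1) *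
      (Real.log (1 - 1 / ((k : ℝ) + 1 + n)) + 1 / ((k : ℝ) + 1 + n - (1 : ℕ)))) := by
    rw [hsi.tsum_sub hs1, lam, lam]; ring
  have hterm : ∀ k : ℕ, r (k + 1) *
      (Real.log (1 - 1 / ((k : ℝ) + 1 + n)) + 1 / ((k : ℝ) + 1 + n - i)) - r (k + 1) *
      (Real.log (1 - 1 / ((k : ℝ) + 1 + n)) + 1 / ((k : ℝ) + 1 + n - (1 : ℕ))) =
      ((i : ℝ) - 1) * ((k + n) / (k + n - (i - 1))) * (r (k + 1) / ((k : ℝ) + n) ^ 2) := by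
    intro k
    have hk : (0 : ℝ) ≤ k := k.cast_nonneg
    have h1 : (k : ℝ) + n ≠ 0 := by linarith
    have h2 : (k : ℝ) + n - (i - 1) ≠ 0 := by linarith
    rw [Nat.cast_one, show (k : ℝ) + 1 + n - i = k + n - (i - 1) by ring,
      show (k : ℝ) + 1 + n - 1 = k + n by ring]
    field_simp
    ring
  have hs := hsi.sub hs1
  have hc := summable_cn hr n
  rw [hdiff, cn, ← tsum_mul_left, ← tsum_mul_left]
  constructor
  · refine (hc.mul_left _).tsum_le_tsum (fun k => ?_) hs
    have hk : (0 : ℝ) ≤ k := k.cast_nonneg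
    rw [hterm]
    refine mul_le_mul_of_nonneg_right ?_ (div_nonneg (hr _ (by omega)).1 (sq_nonneg _))
    refine le_mul_of_one_le_right (by linarith) ?_
    rw [one_le_div (by linarith)]
    linarith
  · refine hs.tsum_le_tsum (fun k => ?_) (hc.mul_left _)
    have hk : (0 : ℝ) ≤ k := k.cast_nonneg
    rw [hterm]
    refine mul_le_mul_of_nonneg_right ?_ (div_nonneg (hr _ (by omega)).1 (sq_nonneg _))
    refine mul_le_mul_of_nonneg_left ?_ (by linarith)
    rw [div_le_div_iff₀ (by linarith) (by linarith)]
    nlinarith [mul_nonneg hk (sub_nonneg.2 hi')]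

theorem tendsto_natCast_div_sub_const (m : ℝ) :
    Tendsto (fun n : ℕ => (n : ℝ) / (n - m)) atTop (nhds 1) := by
  simpa [sub_eq_add_neg] using tendsto_natCast_div_add_atTop (-m)

/-- For each fixed `i ≥ 1`, `c(n)⁻¹ (λ_i(n) - λ_1(n)) → -i + 1` as `n → ∞`. -/
theorem picket_fence_fixed_index
    (r : ℕ → ℕ → ℝ)
    (hr01 : ∀ n k : ℕ, 1 ≤ n → 1 ≤ k → r n k ∈ Set.Icc (0 : ℝ) 1)
    (hrmono : ∀ n : ℕ, 1 ≤ n → ∀ k j : ℕ, 1 ≤ k → k ≤ j → r n j ≤ r n k)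
    (hr1 : ∀ n : ℕ, 1 ≤ n → r n 1 = 1)
    (i : ℕ) (hi : 1 ≤ i) :
    Tendsto (fun n : ℕ => (cn (r n) n)⁻¹ * (lam (r n) n i - lam (r n) n 1))
      atTop (nhds (-(i : ℝ) + 1)) := by
  have hbound : ∀ᶠ n : ℕ in atTop, (cn (r n) n)⁻¹ * (lam (r n) n i - lam (r n) n 1) ∈
      Set.Icc (-(((i : ℝ) - 1) * ((n : ℝ) / (n - (i - 1))))) (-(i : ℝ) + 1) := by
    filter_upwards [eventually_ge_atTop i] with n hin
    have hn := hi.trans hin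
    have hc := cn_pos (hr01 n · hn) (hr1 n hn) hn
    obtain ⟨h1, h2⟩ := lam_one_sub_lam_mem_Icc (hr01 n · hn) hi hin
    rw [inv_mul_eq_div]
    constructor
    · rw [le_div_iff₀ hc]; linarith
    · rw [div_le_iff₀ hc]; linarith
  have hlim : Tendsto (fun n : ℕ => -(((i : ℝ) - 1) * ((n : ℝ) / (n - (i - 1)))))
      atTop (nhds (-(i : ℝ) + 1)) := by
    have h := ((tendsto_natCast_div_sub_const ((i : ℝ) - 1)).const_mul ((i : ℝ) - 1)).neg
    rwa [show -(((i : ℝ) - 1) * 1) = -(i : ℝ) + 1 by ring] at h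
  exact tendsto_of_tendsto_of_tendsto_of_le_of_le' hlim tendsto_const_nhds
    (hbound.mono fun _ h => h.1) (hbound.mono fun _ h => h.2)

end
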